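/- Let f : ℝ^d → ℝ be differentiable with L-Lipschitz continuous gradient (L > 0), and μ-strongly convex (μ > 0), i.e., ⟨x - y, ∇f(x) - ∇f(y)⟩ ≥ μ‖x - y‖² for all x, y. Let T : ℝ^d → ℝ^d be nonexpansive (1-Lipschitz), let γ > 0 and x* ∈ ℝ^d satisfy T(x* - γ∇f(x*)) = x*. Fix x ∈ ℝ^d, and let H : Ω → ℝ^d be measurable with E[H] = ∇f(x) and E[‖H‖²] ≤ M‖∇f(x)‖² + σ² for constants M > 0, σ ∈ ℝ. Set σ₁² = 2(1 + 2M)‖∇f(x*)‖² + 2σ² and ρ = γμ(1 - 2γLM), and assume ρ ∈ (0,1). Then E[‖T(x - γH) - x*‖²] ≤ (1 - ρ)‖x - x*‖² + γ²σ₁². (One-step form of Proposition 1; T generalizes the proximity operator prox_{γg} of a proper lower semicontinuous convex function g, which is nonexpansive and fixes x* = prox_{γg}(x* - γ∇f(x*)) at the solution.) -/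

import Mathlib

open MeasureTheory
open scoped RealInnerProductSpace

section Helpers

variable {E : Type*} [NormedAddCommGroup E] [InnerProductSpace ℝ E] [CompleteSpace E]

lemma aux_line (f : E → ℝ) (hf : Differentiable ℝ f) (y v : E) (t : ℝ) :
    HasDerivAt (fun t : ℝ => f (y + t • v)) ⟪gradient f (y + t • v), v⟫ t := by
  have h1 := (hf (y + t • v)).hasGradientAt.hasFDerivAt
  have h2 : HasDerivAt (fun t : ℝ => y + t • v) v t := by
    simpa using ((hasDerivAt_id t).smul_const v).const_add y
  have h3 := h1.comp_hasDerivAt t h2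
  rw [InnerProductSpace.toDual_apply_apply] at h3
  exact h3

lemma aux_descent (f : E → ℝ) (hf : Differentiable ℝ f) (L : ℝ)
    (hLip : ∀ y z, ‖gradient f y - gradient f z‖ ≤ L * ‖y - z‖) (y v : E) :
    f (y + v) ≤ f y + ⟪gradient f y, v⟫ + L / 2 * ‖v‖ ^ 2 := by
  have hd : ∀ t : ℝ, HasDerivAt
      (fun t : ℝ => f (y + t • v) - t * ⟪gradient f y, v⟫ - L / 2 * ‖v‖ ^ 2 * t ^ 2)
      (⟪gradient f (y + t • v), v⟫ - ⟪gradient f y, v⟫ - L / 2 * ‖v‖ ^ 2 * (2 * t)) t := by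
    intro t
    have h := ((aux_line f hf y v t).sub ((hasDerivAt_id t).mul_const ⟪gradient f y, v⟫)).sub
      ((hasDerivAt_pow 2 t).const_mul (L / 2 * ‖v‖ ^ 2))
    refine HasDerivAt.congr_deriv h ?_
    norm_num
  have hanti := antitoneOn_of_deriv_nonpos (convex_Icc (0 : ℝ) 1)
    (fun t _ => (hd t).continuousAt.continuousWithinAt)
    (fun t _ => (hd t).differentiableAt.differentiableWithinAt)
    (by
      intro t ht
      rw [interior_Icc] at ht
      rw [(hd t).deriv, ← inner_sub_left]
      have h1 := real_inner_le_norm (gradient f (y + t • v) - gradient f y) v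
      have h2 := hLip (y + t • v) y
      rw [add_sub_cancel_left, norm_smul, Real.norm_of_nonneg ht.1.le] at h2
      have h3 := mul_le_mul_of_nonneg_right h2 (norm_nonneg v)
      nlinarith)
  have := hanti (Set.left_mem_Icc.2 zero_le_one) (Set.right_mem_Icc.2 zero_le_one) zero_le_one
  simp only [zero_smul, one_smul, add_zero, zero_mul, one_mul, sub_zero, one_pow, mul_one, ne_eq,
    OfNat.ofNat_ne_zero, not_false_eq_true, zero_pow, mul_zero] at this
  linarith

lemma aux_convex (f : E → ℝ) (hf : Differentiable ℝ f)
    (hm : ∀ y z, 0 ≤ ⟪y - z, gradient f y - gradient f z⟫) (y v : E) :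
    f y + ⟪gradient f y, v⟫ ≤ f (y + v) := by
  have hd : ∀ t : ℝ, HasDerivAt
      (fun t : ℝ => f (y + t • v) - t * ⟪gradient f y, v⟫)
      (⟪gradient f (y + t • v), v⟫ - ⟪gradient f y, v⟫) t := by
    intro t
    have h := ((aux_line f hf y v t).sub ((hasDerivAt_id t).mul_const ⟪gradient f y, v⟫))
    refine HasDerivAt.congr_deriv h ?_
    rw [one_mul]
  have hmono := monotoneOn_of_deriv_nonneg (convex_Icc (0 : ℝ) 1)
    (fun t _ => (hd t).continuousAt.continuousWithinAt)
    (fun t _ => (hd t).differentiableAt.differentiableWithinAt)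
    (by
      intro t ht
      rw [interior_Icc] at ht
      rw [(hd t).deriv, ← inner_sub_left]
      have h1 := hm (y + t • v) y
      rw [add_sub_cancel_left, real_inner_smul_left, real_inner_comm] at h1
      exact nonneg_of_mul_nonneg_right h1 ht.1)
  have := hmono (Set.left_mem_Icc.2 zero_le_one) (Set.right_mem_Icc.2 zero_le_one) zero_le_one
  simp only [zero_smul, one_smul, add_zero, zero_mul, one_mul, sub_zero, one_pow, mul_one, ne_eq,
    OfNat.ofNat_ne_zero, not_false_eq_true, zero_pow, mul_zero] at this
  linarith

lemma aux_half (f : E → ℝ) (hf : Differentiable ℝ f) (L : ℝ) (hL : 0 < L)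
    (hLip : ∀ y z, ‖gradient f y - gradient f z‖ ≤ L * ‖y - z‖)
    (hm : ∀ y z, 0 ≤ ⟪y - z, gradient f y - gradient f z⟫) (y z : E) :
    f z + ⟪gradient f z, y - z⟫ + 1 / (2 * L) * ‖gradient f y - gradient f z‖ ^ 2 ≤ f y := by
  have h1 := aux_descent f hf L hLip y (-(L⁻¹ • (gradient f y - gradient f z)))
  have h2 := aux_convex f hf hm z (y - z + -(L⁻¹ • (gradient f y - gradient f z)))
  have h3 : z + (y - z + -(L⁻¹ • (gradient f y - gradient f z)))
      = y + -(L⁻¹ • (gradient f y - gradient f z)) := by abel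
  rw [h3, inner_add_right] at h2
  rw [norm_neg, norm_smul, mul_pow, Real.norm_of_nonneg (inv_nonneg.2 hL.le)] at h1
  rw [inner_neg_right, real_inner_smul_right] at h1 h2
  have h4 : ⟪gradient f y, gradient f y - gradient f z⟫
      - ⟪gradient f z, gradient f y - gradient f z⟫ = ‖gradient f y - gradient f z‖ ^ 2 := by
    rw [← inner_sub_left, real_inner_self_eq_norm_sq]
  have h5 : L / 2 * (L⁻¹ ^ 2 * ‖gradient f y - gradient f z‖ ^ 2)
      = L⁻¹ * ‖gradient f y - gradient f z‖ ^ 2 / 2 := by field_simp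
  have h6 : 1 / (2 * L) * ‖gradient f y - gradient f z‖ ^ 2
      = L⁻¹ * ‖gradient f y - gradient f z‖ ^ 2 / 2 := by field_simp
  have h7 := congrArg (fun r => L⁻¹ * r) h4
  simp only [mul_sub] at h7
  linarith

lemma aux_coco (f : E → ℝ) (hf : Differentiable ℝ f) (L : ℝ) (hL : 0 < L)
    (hLip : ∀ y z, ‖gradient f y - gradient f z‖ ≤ L * ‖y - z‖)
    (hm : ∀ y z, 0 ≤ ⟪y - z, gradient f y - gradient f z⟫) (y z : E) :
    ‖gradient f y - gradient f z‖ ^ 2 ≤ L * ⟪y - z, gradient f y - gradient f z⟫ := by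
  have h1 := aux_half f hf L hL hLip hm y z
  have h2 := aux_half f hf L hL hLip hm z y
  rw [norm_sub_rev, ← neg_sub y z, inner_neg_right] at h2
  have h3 : ⟪y - z, gradient f y - gradient f z⟫
      = ⟪gradient f y, y - z⟫ - ⟪gradient f z, y - z⟫ := by
    rw [real_inner_comm, inner_sub_left]
  have h4 : 1 / (2 * L) * ‖gradient f y - gradient f z‖ ^ 2
      + 1 / (2 * L) * ‖gradient f y - gradient f z‖ ^ 2
      = ‖gradient f y - gradient f z‖ ^ 2 / L := by field_simp; ring
  have h5 : ‖gradient f y - gradient f z‖ ^ 2 / L ≤ ⟪y - z, gradient f y - gradient f z⟫ := by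
    linarith
  rw [div_le_iff₀ hL] at h5
  linarith

lemma aux_sq {E : Type*} [NormedAddCommGroup E] [InnerProductSpace ℝ E] (a b : E) : ‖a - b‖ ^ 2 ≤ 2 * ‖a‖ ^ 2 + 2 * ‖b‖ ^ 2 := by
  have h1 := norm_sub_sq_real a b
  have h2 := norm_add_sq_real a b
  nlinarith [sq_nonneg ‖a + b‖]

end Helpers

/-- One-step form of Proposition 1: a proximal (here: nonexpansive-map)
stochastic gradient step for a strongly convex smooth `f`, under the weak
growth condition, contracts the squared distance to the fixed point `x*` up to
the noise term `γ²σ₁²`. -/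
theorem stmt_6 {d : ℕ} {Ω : Type*} [MeasurableSpace Ω] (P : Measure Ω)
    [IsProbabilityMeasure P]
    (f : EuclideanSpace ℝ (Fin d) → ℝ) (hfdiff : Differentiable ℝ f)
    (L : ℝ) (hL : 0 < L)
    (hLip : ∀ y z, ‖gradient f y - gradient f z‖ ≤ L * ‖y - z‖)
    (μ : ℝ) (hμ : 0 < μ)
    (hsc : ∀ y z, ⟪y - z, gradient f y - gradient f z⟫ ≥ μ * ‖y - z‖ ^ 2)
    (T : EuclideanSpace ℝ (Fin d) → EuclideanSpace ℝ (Fin d))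
    (hT : LipschitzWith 1 T)
    (γ : ℝ) (hγ : 0 < γ)
    (xstar : EuclideanSpace ℝ (Fin d))
    (hfix : T (xstar - γ • gradient f xstar) = xstar)
    (x : EuclideanSpace ℝ (Fin d))
    (H : Ω → EuclideanSpace ℝ (Fin d)) (hHmeas : Measurable H)
    (hHint : Integrable H P) (hHL2 : Integrable (fun a => ‖H a‖ ^ 2) P)
    (M σ : ℝ) (hM : 0 < M)
    (hunbiased : ∫ a, H a ∂P = gradient f x)
    (hwgc : ∫ a, ‖H a‖ ^ 2 ∂P ≤ M * ‖gradient f x‖ ^ 2 + σ ^ 2)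
    (σ1sq ρ : ℝ)
    (hσ1 : σ1sq = 2 * (1 + 2 * M) * ‖gradient f xstar‖ ^ 2 + 2 * σ ^ 2)
    (hρ : ρ = γ * μ * (1 - 2 * γ * L * M)) (hρmem : ρ ∈ Set.Ioo (0 : ℝ) 1) :
    ∫ a, ‖T (x - γ • H a) - xstar‖ ^ 2 ∂P ≤
      (1 - ρ) * ‖x - xstar‖ ^ 2 + γ ^ 2 * σ1sq := by
  have hm : ∀ y z, 0 ≤ ⟪y - z, gradient f y - gradient f z⟫ := fun y z =>
    le_trans (by positivity) (hsc y z)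
  have hco := aux_coco f hfdiff L hL hLip hm x xstar
  have hs := hsc x xstar
  have hpt : ∀ a, ‖T (x - γ • H a) - xstar‖ ^ 2 ≤
      ‖x - xstar‖ ^ 2 - 2 * γ * (⟪x - xstar, H a⟫ - ⟪x - xstar, gradient f xstar⟫)
        + γ ^ 2 * (2 * ‖H a‖ ^ 2 + 2 * ‖gradient f xstar‖ ^ 2) := by
    intro a
    have h1 : ‖T (x - γ • H a) - xstar‖ ≤ ‖(x - xstar) - γ • (H a - gradient f xstar)‖ := by
      have h := hT.dist_le_mul (x - γ • H a) (xstar - γ • gradient f xstar)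
      rw [hfix, dist_eq_norm, dist_eq_norm, NNReal.coe_one, one_mul] at h
      refine h.trans_eq ?_
      congr 1
      rw [smul_sub]; abel
    have h2 := pow_le_pow_left₀ (norm_nonneg _) h1 2
    rw [norm_sub_sq_real (x - xstar) (γ • _), real_inner_smul_right, inner_sub_right, norm_smul, mul_pow,
      Real.norm_of_nonneg hγ.le] at h2
    have h3 := mul_le_mul_of_nonneg_left (aux_sq (H a) (gradient f xstar)) (sq_nonneg γ)
    linarith
  have hi1 : Integrable (fun a => ⟪x - xstar, H a⟫) P := hHint.const_inner _
  have hi2 : Integrable (fun a => 2 * γ * (⟪x - xstar, H a⟫ - ⟪x - xstar, gradient f xstar⟫)) P :=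
    (hi1.sub (integrable_const _)).const_mul _
  have hiA : Integrable (fun a => ‖x - xstar‖ ^ 2
      - 2 * γ * (⟪x - xstar, H a⟫ - ⟪x - xstar, gradient f xstar⟫)) P :=
    (integrable_const _).sub ((hi1.sub (integrable_const _)).const_mul _)
  have hiB : Integrable (fun a => γ ^ 2 * (2 * ‖H a‖ ^ 2 + 2 * ‖gradient f xstar‖ ^ 2)) P :=
    ((hHL2.const_mul 2).add (integrable_const _)).const_mul _
  have hle := integral_mono_of_nonneg (μ := P) (Filter.Eventually.of_forall
    (fun a => sq_nonneg ‖T (x - γ • H a) - xstar‖)) (hiA.add hiB)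
    (Filter.Eventually.of_forall hpt)
  have heq : ∫ a, (‖x - xstar‖ ^ 2
      - 2 * γ * (⟪x - xstar, H a⟫ - ⟪x - xstar, gradient f xstar⟫)
        + γ ^ 2 * (2 * ‖H a‖ ^ 2 + 2 * ‖gradient f xstar‖ ^ 2)) ∂P
      = ‖x - xstar‖ ^ 2 - 2 * γ * ⟪x - xstar, gradient f x - gradient f xstar⟫
        + γ ^ 2 * (2 * (∫ a, ‖H a‖ ^ 2 ∂P) + 2 * ‖gradient f xstar‖ ^ 2) := by
    rw [integral_add hiA hiB,
      integral_sub (integrable_const _) hi2,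
      integral_const_mul, integral_sub hi1 (integrable_const _), integral_const_mul,
      integral_add (hHL2.const_mul 2) (integrable_const _), integral_const_mul,
      integral_inner hHint, hunbiased, inner_sub_right]
    simp
  have hle2 := hle.trans_eq heq
  refine hle2.trans ?_
  have hg : ‖gradient f x‖ ^ 2 ≤ 2 * ‖gradient f x - gradient f xstar‖ ^ 2
      + 2 * ‖gradient f xstar‖ ^ 2 := by
    have h := aux_sq (gradient f x - gradient f xstar) (-gradient f xstar)
    simpa using h
  obtain ⟨hρ0, -⟩ := hρmem
  have hk : 0 < 1 - 2 * γ * L * M := by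
    rw [hρ] at hρ0
    exact pos_of_mul_pos_right hρ0 (by positivity)
  have hD : 0 ≤ ρ * ‖x - xstar‖ ^ 2 := by positivity
  generalize ⟪x - xstar, gradient f x - gradient f xstar⟫ = I at *
  generalize ‖gradient f x - gradient f xstar‖ ^ 2 = e at *
  generalize ‖x - xstar‖ ^ 2 = D at *
  have a1 := mul_le_mul_of_nonneg_left hwgc (by positivity : 0 ≤ 2 * γ ^ 2)
  have a2 := mul_le_mul_of_nonneg_left hg (by positivity : 0 ≤ 2 * γ ^ 2 * M)
  have a3 := mul_le_mul_of_nonneg_left hco (by positivity : 0 ≤ 4 * γ ^ 2 * M)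
  have a4 := mul_le_mul_of_nonneg_left hs (by positivity : 0 ≤ 2 * γ * (1 - 2 * γ * L * M))
  rw [hσ1]
  rw [hρ] at hD ⊢
  linarith
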